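/- arXiv:1002.3239 — 12 statements merged into one kernel-verified Lean document; each statement's English description precedes it below -/
import Mathlib

section
/- Let m be any vector of messages (real-valued functions, hence finite), with c a parameter vector of nonzero reals. Then the beliefs derived from m are admissible for f: there exists a constant κ such that for all x : Fin n → X, f(x) = κ + ∑_i c_i·b_i(x i) + ∑_{α∈A} c_α·(b_α(x) − ∑_{k∈α} c_k·b_k(x k)). -/
/-- For any vector of (real-valued, hence finite) messages and any
parameter vector `c` of nonzero reals, the beliefs derived from the messages are
admissible for the objective function `f`. -/
theorem splitting_beliefs_admissible
    {X : Type} [Fintype X] [Nonempty X] {n : ℕ}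
    (A : Finset (Finset (Fin n))) (hAne : ∀ α ∈ A, α.Nonempty)
    (φ : Fin n → X → ℝ) (ψ : Finset (Fin n) → (Fin n → X) → ℝ)
    (hψ : ∀ α ∈ A, ∀ x y : Fin n → X, (∀ i ∈ α, x i = y i) → ψ α x = ψ α y)
    (f : (Fin n → X) → ℝ)
    (hf : ∀ x, f x = ∑ i, φ i (x i) + ∑ α ∈ A, ψ α x)
    (cv : Fin n → ℝ) (cf : Finset (Fin n) → ℝ)
    (hcv : ∀ i, cv i ≠ 0) (hcf : ∀ α ∈ A, cf α ≠ 0)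
    (mva : Fin n → Finset (Fin n) → X → ℝ)
    (maf : Finset (Fin n) → Fin n → X → ℝ)
    (bv : Fin n → X → ℝ) (bf : Finset (Fin n) → (Fin n → X) → ℝ)
    (hbv : ∀ (i : Fin n) (t : X), bv i t = φ i t / cv i +
      ∑ α ∈ A.filter (fun α => i ∈ α), cf α * maf α i t)
    (hbf : ∀ α ∈ A, ∀ x : Fin n → X, bf α x = ψ α x / cf α +
      ∑ k ∈ α, cv k * (φ k (x k) / cv k + (cf α - 1) * maf α k (x k) +
        ∑ β ∈ (A.filter (fun β => k ∈ β)).erase α, cf β * maf β k (x k))) :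
    ∃ κ : ℝ, ∀ x : Fin n → X, f x = κ + ∑ i, cv i * bv i (x i) +
      ∑ α ∈ A, cf α * (bf α x - ∑ k ∈ α, cv k * bv k (x k)) := by
  have factor_term : ∀ α ∈ A, ∀ x : Fin n → X,
      cf α * (bf α x - ∑ k ∈ α, cv k * bv k (x k)) =
        ψ α x - ∑ k ∈ α, cv k * (cf α * maf α k (x k)) := by
    intro α hα x
    have hbf' : bf α x = ψ α x / cf α + ∑ k ∈ α, cv k * (bv k (x k) - maf α k (x k)) := by
      rw [hbf α hα x]
      congr 1
      refine Finset.sum_congr rfl fun k hk => ?_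
      rw [hbv, ← Finset.add_sum_erase _ _ (Finset.mem_filter.mpr ⟨hα, hk⟩)]
      ring
    simp only [mul_sub, Finset.sum_sub_distrib] at hbf'
    have hsum : ∑ k ∈ α, cv k * (cf α * maf α k (x k)) =
        cf α * ∑ k ∈ α, cv k * maf α k (x k) := by
      rw [Finset.mul_sum]
      exact Finset.sum_congr rfl fun k _ => by ring
    rw [hbf', hsum]
    have := hcf α hα
    field_simp
    ring
  have variable_term : ∀ x : Fin n → X, ∑ i, cv i * bv i (x i) =
      ∑ i, φ i (x i) + ∑ α ∈ A, ∑ k ∈ α, cv k * (cf α * maf α k (x k)) := by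
    intro x
    have swap : ∑ α ∈ A, ∑ k ∈ α, cv k * (cf α * maf α k (x k)) =
        ∑ k, ∑ α ∈ A.filter (fun α => k ∈ α), cv k * (cf α * maf α k (x k)) :=
      Finset.sum_comm' (by simp)
    rw [swap, ← Finset.sum_add_distrib]
    refine Finset.sum_congr rfl fun i _ => ?_
    rw [hbv, mul_add, mul_div_cancel₀ _ (hcv i), Finset.mul_sum]
  refine ⟨0, fun x => ?_⟩
  rw [hf, variable_term, Finset.sum_congr rfl fun α hα => factor_term α hα x,
    Finset.sum_sub_distrib]
  ring
end

section
/- Let m be a fixed point of the splitting message updates with parameter vector c of nonzero reals. Then the beliefs derived from m are min-consistent: for every α ∈ A and every i ∈ α there is a constant κ_{αi} such that for all x_i ∈ X, the minimum of b_α(x) over all x : Fin n → X with i-th coordinate equal to x_i equals κ_{αi} + b_i(x_i). -/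
/-- Translating a function on a nonempty finite set translates its minimum. -/
theorem sInf_eq_add_of_eq_add {ι : Type*} [Finite ι] {p : ι → Prop} (hp : ∃ x, p x)
    {f g : ι → ℝ} {a : ℝ} (h : ∀ x, p x → f x = a + g x) :
    sInf {r : ℝ | ∃ x, p x ∧ f x = r} = a + sInf {r : ℝ | ∃ x, p x ∧ g x = r} := by
  have key : ∀ u : ι → ℝ, sInf {r : ℝ | ∃ x, p x ∧ u x = r} = ⨅ x : {x // p x}, u x := by
    intro u
    rw [iInf]
    congr 1
    ext r
    simp
  have : Nonempty {x // p x} := nonempty_subtype.mpr hp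
  rw [key f, key g, add_ciInf (Set.finite_range _).bddBelow]
  exact iInf_congr fun x => h x x.2

/-- If the messages are a fixed point of the splitting message
updates (with parameter vector `c` of nonzero reals), then the derived beliefs
are min-consistent. -/
theorem splitting_fixed_point_min_consistent
    {X : Type} [Fintype X] [Nonempty X] {n : ℕ}
    (A : Finset (Finset (Fin n))) (hAne : ∀ α ∈ A, α.Nonempty)
    (φ : Fin n → X → ℝ) (ψ : Finset (Fin n) → (Fin n → X) → ℝ)
    (hψ : ∀ α ∈ A, ∀ x y : Fin n → X, (∀ i ∈ α, x i = y i) → ψ α x = ψ α y)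
    (cv : Fin n → ℝ) (cf : Finset (Fin n) → ℝ)
    (hcv : ∀ i, cv i ≠ 0) (hcf : ∀ α ∈ A, cf α ≠ 0)
    (mva : Fin n → Finset (Fin n) → X → ℝ)
    (maf : Finset (Fin n) → Fin n → X → ℝ)
    -- `m` is a fixed point of the splitting message updates:
    (κ1 : Fin n → Finset (Fin n) → ℝ) (κ2 : Finset (Fin n) → Fin n → ℝ)
    (hfix1 : ∀ i : Fin n, ∀ α ∈ A, i ∈ α → ∀ t : X,
      mva i α t = κ1 i α + φ i t / cv i + (cf α - 1) * maf α i t +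
        ∑ β ∈ (A.filter (fun β => i ∈ β)).erase α, cf β * maf β i t)
    (hfix2 : ∀ α ∈ A, ∀ i ∈ α, ∀ t : X,
      maf α i t = κ2 α i + sInf {r : ℝ | ∃ x : Fin n → X, x i = t ∧
        ψ α x / cf α + (cv i - 1) * mva i α t +
          ∑ k ∈ α.erase i, cv k * mva k α (x k) = r})
    -- the beliefs derived from the messages:
    (bv : Fin n → X → ℝ) (bf : Finset (Fin n) → (Fin n → X) → ℝ)
    (hbv : ∀ (i : Fin n) (t : X), bv i t = φ i t / cv i +
      ∑ α ∈ A.filter (fun α => i ∈ α), cf α * maf α i t)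
    (hbf : ∀ α ∈ A, ∀ x : Fin n → X, bf α x = ψ α x / cf α +
      ∑ k ∈ α, cv k * (φ k (x k) / cv k + (cf α - 1) * maf α k (x k) +
        ∑ β ∈ (A.filter (fun β => k ∈ β)).erase α, cf β * maf β k (x k))) :
    ∀ α ∈ A, ∀ i ∈ α, ∃ κ : ℝ, ∀ t : X,
      sInf {r : ℝ | ∃ x : Fin n → X, x i = t ∧ bf α x = r} = κ + bv i t := by
  intro α hα i hi
  refine ⟨κ1 i α - κ2 α i - ∑ k ∈ α, cv k * κ1 k α, fun t => ?_⟩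
  have hsum : ∀ x : Fin n → X, bf α x = ψ α x / cf α +
      ∑ k ∈ α, cv k * mva k α (x k) - ∑ k ∈ α, cv k * κ1 k α := by
    intro x
    rw [hbf α hα x, add_sub_assoc, ← Finset.sum_sub_distrib]
    congr 1
    refine Finset.sum_congr rfl fun k hk => ?_
    rw [hfix1 k α hα hk]
    ring
  have hbelief : mva i α t = κ1 i α + bv i t - maf α i t := by
    rw [hfix1 i α hα hi t, hbv i t,
      ← Finset.add_sum_erase _ _ (Finset.mem_filter.mpr ⟨hα, hi⟩)]
    ring
  rw [sInf_eq_add_of_eq_add (p := fun x : Fin n → X => x i = t) ⟨fun _ => t, rfl⟩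
    (a := mva i α t - ∑ k ∈ α, cv k * κ1 k α)
    (g := fun x => ψ α x / cf α + (cv i - 1) * mva i α t +
      ∑ k ∈ α.erase i, cv k * mva k α (x k))]
  · linarith [hfix2 α hα i hi t]
  · intro x hx
    rw [hsum x, ← Finset.add_sum_erase α (fun k => cv k * mva k α (x k)) hi, hx]
    ring
end

section
/- Let b be a vector of min-consistent beliefs and suppose x* is a unique estimate for b. Then for every factor α ∈ A, x* minimizes b_α (i.e., b_α(x*) ≤ b_α(x) for all x), and for every i ∈ α, x* minimizes the difference b_α − b_i (i.e., b_α(x*) − b_i(x* i) ≤ b_α(x) − b_i(x i) for all x). -/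
/-- If `b` is a vector of min-consistent beliefs admitting a unique
estimate `x*`, then `x*` minimizes every factor belief `b_α` and, for every
`i ∈ α`, minimizes the difference `b_α − b_i`. -/
theorem unique_estimate_minimizes_factor_beliefs
    {X : Type} [Fintype X] [Nonempty X] {n : ℕ}
    (A : Finset (Finset (Fin n))) (hAne : ∀ α ∈ A, α.Nonempty)
    (bv : Fin n → X → ℝ) (bf : Finset (Fin n) → (Fin n → X) → ℝ)
    (hbfdep : ∀ α ∈ A, ∀ x y : Fin n → X, (∀ i ∈ α, x i = y i) → bf α x = bf α y)
    -- min-consistency: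
    (hmc : ∀ α ∈ A, ∀ i ∈ α, ∃ κ : ℝ, ∀ t : X,
      sInf {r : ℝ | ∃ x : Fin n → X, x i = t ∧ bf α x = r} = κ + bv i t)
    -- `xs` is a unique estimate for the beliefs:
    (xs : Fin n → X)
    (hxs : ∀ i : Fin n, ∀ y : X, y ≠ xs i → bv i (xs i) < bv i y) :
    ∀ α ∈ A, (∀ x : Fin n → X, bf α xs ≤ bf α x) ∧
      (∀ i ∈ α, ∀ x : Fin n → X,
        bf α xs - bv i (xs i) ≤ bf α x - bv i (x i)) := by
  have lower : ∀ (α : Finset (Fin n)) (i : Fin n) (x : Fin n → X),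
      sInf {r : ℝ | ∃ y : Fin n → X, y i = x i ∧ bf α y = r} ≤ bf α x := by
    intro α i x
    refine csInf_le (((Set.finite_range (bf α)).subset ?_).bddBelow) ⟨x, rfl, rfl⟩
    rintro r ⟨y, -, rfl⟩
    exact ⟨y, rfl⟩
  intro α hα
  obtain ⟨m, hm⟩ := Finite.exists_min (bf α)
  have le_inf : ∀ i, bf α m ≤ sInf {r : ℝ | ∃ y : Fin n → X, y i = xs i ∧ bf α y = r} := by
    intro i
    refine le_csInf ⟨_, xs, rfl, rfl⟩ ?_
    rintro r ⟨y, -, rfl⟩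
    exact hm y
  have agree : ∀ i ∈ α, m i = xs i := by
    intro i hi
    by_contra hne
    obtain ⟨κ, hκ⟩ := hmc α hα i hi
    have h₁ := lower α i m
    have h₂ := le_inf i
    rw [hκ] at h₁ h₂
    linarith [hxs i (m i) hne]
  have heq : bf α m = bf α xs := hbfdep α hα m xs agree
  refine ⟨fun x => heq ▸ hm x, fun i hi x => ?_⟩
  obtain ⟨κ, hκ⟩ := hmc α hα i hi
  have h₁ := lower α i x
  have h₂ := le_inf i
  rw [hκ] at h₁ h₂
  linarith
end

section
/- Let b be a vector of admissible and min-consistent beliefs for f with parameter vector c of nonzero reals, and suppose that for every variable i the function x ↦ c_i·b_i(x i) + ∑_{α∈∂i} c_α·(b_α(x) − c_i·b_i(x i)) can be written as a conical combination of the beliefs {b_i} ∪ {b_α : α ∈ ∂i}: there exist nonnegative reals d_{ii}, d_{αα} and d_{iα} (α ∈ ∂i) and a constant κ_i with c_i·b_i(x i) + ∑_{α∈∂i} c_α·(b_α(x) − c_i·b_i(x i)) = κ_i + d_{ii}·b_i(x i) + ∑_{α∈∂i} d_{αα}·b_α(x) + ∑_{α∈∂i} d_{iα}·(b_α(x) −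 b_i(x i)) for all x. If the beliefs admit a unique estimate x*, then x* is a local minimum of f with respect to the Hamming distance: for every j : Fin n and every y ∈ X, f(x*) ≤ f(Function.update x* j y). -/
section MinMarginal

variable {ι X : Type*} [Finite ι] [Finite X]

/-- The value of `g` at `x` bounds its min-marginal at `x i` from above. -/
theorem sInf_minMarginal_le (g : (ι → X) → ℝ) (i : ι) (x : ι → X) :
    sInf {r : ℝ | ∃ z : ι → X, z i = x i ∧ g z = r} ≤ g x :=
  csInf_le ((Set.finite_range g).bddBelow.mono (by rintro _ ⟨z, -, rfl⟩; exact ⟨z, rfl⟩))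
    ⟨x, rfl, rfl⟩

/-- At a global minimizer of `g`, the min-marginal equals the value of `g`. -/
theorem sInf_minMarginal_eq (g : (ι → X) → ℝ) (i : ι) (x : ι → X) (hx : ∀ z, g x ≤ g z) :
    sInf {r : ℝ | ∃ z : ι → X, z i = x i ∧ g z = r} = g x :=
  le_antisymm (sInf_minMarginal_le g i x)
    (le_csInf ⟨g x, x, rfl, rfl⟩ (by rintro _ ⟨z, -, rfl⟩; exact hx z))

/-- If `g` depends only on the coordinates in `s`, its min-marginals over `s` agree with `b` up to
constants, and each `b i` is uniquely minimized at `xs i`, then `g` is minimized at `xs`. -/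
theorem le_of_minConsistent (s : Finset ι) (g : (ι → X) → ℝ) (b : ι → X → ℝ)
    (hdep : ∀ x y : ι → X, (∀ i ∈ s, x i = y i) → g x = g y)
    (hmc : ∀ i ∈ s, ∃ κ : ℝ, ∀ t : X,
      sInf {r : ℝ | ∃ x : ι → X, x i = t ∧ g x = r} = κ + b i t)
    (xs : ι → X) (hxs : ∀ i, ∀ y : X, y ≠ xs i → b i (xs i) < b i y) (x : ι → X) :
    g xs ≤ g x := by
  have : Nonempty (ι → X) := ⟨xs⟩
  obtain ⟨z, hz⟩ := Finite.exists_min g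
  suffices h : ∀ i ∈ s, xs i = z i from (hdep xs z h).trans_le (hz x)
  intro i hi
  by_contra hne
  obtain ⟨κ, hκ⟩ := hmc i hi
  have h₁ := hκ (z i)
  rw [sInf_minMarginal_eq g i z hz] at h₁
  have h₂ : g z ≤ sInf {r : ℝ | ∃ x : ι → X, x i = xs i ∧ g x = r} :=
    le_csInf ⟨g xs, xs, rfl, rfl⟩ (by rintro _ ⟨w, -, rfl⟩; exact hz w)
  rw [hκ (xs i)] at h₂
  linarith [hxs i (z i) (Ne.symm hne)]

end MinMarginal

/-- A sum of functions of single coordinates changes, under an update at `j`, only in the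
`j`-th summand. -/
theorem sum_update_sub_sum {ι X : Type*} [DecidableEq ι] (s : Finset ι) (g : ι → X → ℝ)
    (x : ι → X) (j : ι) (y : X) :
    ∑ i ∈ s, g i (Function.update x j y i) - ∑ i ∈ s, g i (x i) =
      if j ∈ s then g j y - g j (x j) else 0 := by
  rw [← Finset.sum_sub_distrib, ← Finset.sum_ite_eq s j (fun i => g i y - g i (x i))]
  refine Finset.sum_congr rfl fun i _ => ?_
  by_cases h : j = i
  · subst h; simp
  · simp [h, Function.update_of_ne (Ne.symm h)]


/-- If the beliefs are admissible and min-consistent for `f` and,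
for every variable `i`, the part of the reparameterization depending on `x_i`
can be written as a conical combination of the beliefs, then any unique
estimate `x*` is a local minimum of `f` with respect to the Hamming distance. -/
theorem unique_estimate_local_minimum
    {X : Type} [Fintype X] [Nonempty X] {n : ℕ}
    (A : Finset (Finset (Fin n))) (hAne : ∀ α ∈ A, α.Nonempty)
    (φ : Fin n → X → ℝ) (ψ : Finset (Fin n) → (Fin n → X) → ℝ)
    (hψ : ∀ α ∈ A, ∀ x y : Fin n → X, (∀ i ∈ α, x i = y i) → ψ α x = ψ α y)
    (f : (Fin n → X) → ℝ)
    (hf : ∀ x, f x = ∑ i, φ i (x i) + ∑ α ∈ A, ψ α x)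
    (cv : Fin n → ℝ) (cf : Finset (Fin n) → ℝ)
    (hcv : ∀ i, cv i ≠ 0) (hcf : ∀ α ∈ A, cf α ≠ 0)
    (bv : Fin n → X → ℝ) (bf : Finset (Fin n) → (Fin n → X) → ℝ)
    (hbfdep : ∀ α ∈ A, ∀ x y : Fin n → X, (∀ i ∈ α, x i = y i) → bf α x = bf α y)
    -- admissibility:
    (κ : ℝ)
    (hadm : ∀ x : Fin n → X, f x = κ + ∑ i, cv i * bv i (x i) +
      ∑ α ∈ A, cf α * (bf α x - ∑ k ∈ α, cv k * bv k (x k)))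
    -- min-consistency:
    (hmc : ∀ α ∈ A, ∀ i ∈ α, ∃ κ' : ℝ, ∀ t : X,
      sInf {r : ℝ | ∃ x : Fin n → X, x i = t ∧ bf α x = r} = κ' + bv i t)
    -- for every variable `i`, the part of the reparameterization involving `x_i`
    -- is a conical combination of the beliefs `{b_i} ∪ {b_α : α ∈ ∂i}`:
    (hconi : ∀ i : Fin n, ∃ (dii : ℝ) (dff : Finset (Fin n) → ℝ)
        (dif : Finset (Fin n) → ℝ) (κi : ℝ),
      0 ≤ dii ∧ (∀ α ∈ A.filter (fun α => i ∈ α), 0 ≤ dff α) ∧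
      (∀ α ∈ A.filter (fun α => i ∈ α), 0 ≤ dif α) ∧
      ∀ x : Fin n → X,
        cv i * bv i (x i) + ∑ α ∈ A.filter (fun α => i ∈ α),
            cf α * (bf α x - cv i * bv i (x i)) =
          κi + dii * bv i (x i) +
            ∑ α ∈ A.filter (fun α => i ∈ α), dff α * bf α x +
            ∑ α ∈ A.filter (fun α => i ∈ α), dif α * (bf α x - bv i (x i)))
    -- `xs` is a unique estimate for the beliefs:
    (xs : Fin n → X)
    (hxs : ∀ i : Fin n, ∀ y : X, y ≠ xs i → bv i (xs i) < bv i y) :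
    ∀ (j : Fin n) (y : X), f xs ≤ f (Function.update xs j y) := by
  intro j y
  set x' := Function.update xs j y with hx'
  have hx'j : x' j = y := by simp [hx']
  have hmin : ∀ α ∈ A, bf α xs ≤ bf α x' := fun α hα =>
    le_of_minConsistent α (bf α) bv (hbfdep α hα) (hmc α hα) xs hxs x'
  have hbv : bv j (xs j) ≤ bv j (x' j) := by
    by_cases h : x' j = xs j
    · rw [h]
    · exact (hxs j _ h).le
  have hdiff : ∀ α ∈ A, j ∈ α → bf α xs - bv j (xs j) ≤ bf α x' - bv j (x' j) := by
    intro α hα hj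
    obtain ⟨κ', hκ'⟩ := hmc α hα j hj
    have h₁ := sInf_minMarginal_eq (bf α) j xs
      (le_of_minConsistent α (bf α) bv (hbfdep α hα) (hmc α hα) xs hxs)
    have h₂ := sInf_minMarginal_le (bf α) j x'
    rw [hκ'] at h₁ h₂
    linarith
  obtain ⟨dii, dff, dif, κi, hdii, hdff, hdif, heq⟩ := hconi j
  have hff : ∑ α ∈ A.filter (fun α => j ∈ α), dff α * bf α xs ≤
      ∑ α ∈ A.filter (fun α => j ∈ α), dff α * bf α x' :=
    Finset.sum_le_sum fun α hα =>
      mul_le_mul_of_nonneg_left (hmin α (Finset.mem_filter.1 hα).1) (hdff α hα)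
  have hif : ∑ α ∈ A.filter (fun α => j ∈ α), dif α * (bf α xs - bv j (xs j)) ≤
      ∑ α ∈ A.filter (fun α => j ∈ α), dif α * (bf α x' - bv j (x' j)) :=
    Finset.sum_le_sum fun α hα =>
      mul_le_mul_of_nonneg_left
        (hdiff α (Finset.mem_filter.1 hα).1 (Finset.mem_filter.1 hα).2) (hdif α hα)
  have hii := mul_le_mul_of_nonneg_left hbv hdii
  have hvar : ∑ i, cv i * bv i (x' i) - ∑ i, cv i * bv i (xs i) =
      cv j * bv j (x' j) - cv j * bv j (xs j) := by
    rw [hx', sum_update_sub_sum Finset.univ (fun i t => cv i * bv i t)]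
    simp
  have hfac : ∑ α ∈ A, cf α * (bf α x' - ∑ k ∈ α, cv k * bv k (x' k)) -
        ∑ α ∈ A, cf α * (bf α xs - ∑ k ∈ α, cv k * bv k (xs k)) =
      ∑ α ∈ A.filter (fun α => j ∈ α), cf α * (bf α x' - cv j * bv j (x' j)) -
        ∑ α ∈ A.filter (fun α => j ∈ α), cf α * (bf α xs - cv j * bv j (xs j)) := by
    rw [← Finset.sum_sub_distrib, ← Finset.sum_sub_distrib, Finset.sum_filter]
    refine Finset.sum_congr rfl fun α hα => ?_
    have hs := sum_update_sub_sum α (fun i t => cv i * bv i t) xs j y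
    rw [← hx'] at hs
    split_ifs with hj
    · rw [if_pos hj] at hs
      rw [hx'j]
      linear_combination (-cf α) * hs
    · rw [if_neg hj] at hs
      have hb : bf α x' = bf α xs := hbfdep α hα _ _ fun i hi =>
        Function.update_of_ne (ne_of_mem_of_not_mem hi hj) _ _
      linear_combination cf α * hb - cf α * hs
  have h₁ := heq xs
  have h₂ := heq x'
  rw [hadm xs, hadm x']
  linarith
end

section
/- Let f : (Fin n → ℝ) → ℝ be convex and differentiable. If x* is a local minimum of f with respect to single-coordinate changes, i.e., for every j : Fin n and every t ∈ ℝ one has f(x*) ≤ f(Function.update x* j t), then x* is a global minimum of f: f(x*) ≤ f(y) for all y. -/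
/-- The Fréchet derivative at a point that is minimal along every coordinate line vanishes. -/
theorem fderiv_eq_zero_of_forall_le_update {ι : Type*} [Fintype ι] [DecidableEq ι]
    {f : (ι → ℝ) → ℝ} {x : ι → ℝ} (hf : DifferentiableAt ℝ f x)
    (hmin : ∀ (j : ι) (t : ℝ), f x ≤ f (Function.update x j t)) :
    fderiv ℝ f x = 0 := by
  refine ContinuousLinearMap.coe_injective (LinearMap.pi_ext' fun j => LinearMap.ext_ring ?_)
  have hderiv : HasDerivAt (fun t => f (Function.update x j t))
      (fderiv ℝ f x (Pi.single j 1)) (x j) :=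
    HasFDerivAt.comp_hasDerivAt_of_eq (x j) hf.hasFDerivAt (hasDerivAt_update x j (x j))
      (Function.update_eq_self j x).symm
  have hlocal : IsLocalMin (fun t => f (Function.update x j t)) (x j) :=
    Filter.Eventually.of_forall fun t => by simpa using hmin j t
  simpa using hlocal.hasDerivAt_eq_zero hderiv

/-- A critical point of a convex function on a real normed space is a global minimum. -/
theorem ConvexOn.le_of_hasFDerivAt_zero {E : Type*} [NormedAddCommGroup E] [NormedSpace ℝ E]
    {f : E → ℝ} {x : E} (hconv : ConvexOn ℝ Set.univ f)
    (hf : HasFDerivAt f (0 : E →L[ℝ] ℝ) x) (y : E) : f x ≤ f y := by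
  have hline : ConvexOn ℝ Set.univ (f ∘ AffineMap.lineMap (k := ℝ) x y) :=
    hconv.comp_affineMap (AffineMap.lineMap x y)
  have hderiv : HasDerivAt (f ∘ AffineMap.lineMap (k := ℝ) x y) 0 0 := by
    simpa using HasFDerivAt.comp_hasDerivAt_of_eq (0 : ℝ) hf AffineMap.hasDerivAt_lineMap
      (AffineMap.lineMap_apply_zero x y).symm
  have hslope := hline.le_slope_of_hasDerivAt (Set.mem_univ 0) (Set.mem_univ 1) one_pos hderiv
  simpa [slope_def_field] using hslope


/-- A point of a differentiable convex function `f` on `Fin n → ℝ`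
that is optimal with respect to single-coordinate changes is a global
minimum. -/
theorem coordinatewise_local_min_of_convex_is_global
    {n : ℕ} (f : (Fin n → ℝ) → ℝ)
    (hconv : ConvexOn ℝ Set.univ f)
    (hdiff : Differentiable ℝ f)
    (x : Fin n → ℝ)
    (hloc : ∀ (j : Fin n) (t : ℝ), f x ≤ f (Function.update x j t)) :
    ∀ y : Fin n → ℝ, f x ≤ f y :=
  hconv.le_of_hasFDerivAt_zero
    (fderiv_eq_zero_of_forall_le_update (hdiff x) hloc ▸ (hdiff x).hasFDerivAt)
end

section
/- Let d assign nonnegative reals d_{ii} to each variable i, d_{αα} to each factor α, and d_{iα} to each pair i ∈ α. Define c_α = d_{αα} + ∑_{i∈α} d_{iα} for each α, and assume c_α > 0 for all α. For each variable i, let s_i = 1 − ∑_{α∈∂i} c_α; if s_i ≠ 0, assume d_{ii} ≠ ∑_{α∈∂i} d_{iα} and set c_i = (d_{ii} − ∑_{α∈∂i} d_{iα})/s_i; if s_i = 0, assume d_{ii} = ∑_{α∈∂i} d_{iα} and let c_i be an arbitrary nonzero real. Then for every vector of beliefs b and every x : Fin n → X: ∑_i c_i·b_i(x i) + ∑_α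 c_α·(b_α(x) − ∑_{k∈α} c_k·b_k(x k)) = ∑_i d_{ii}·b_i(x i) + ∑_α d_{αα}·b_α(x) + ∑_{α}∑_{i∈α} d_{iα}·(b_α(x) − b_i(x i)). In particular, any vector of beliefs admissible for f with this parameter vector c expresses f as a conical combination of the beliefs. -/
/-- Summing over factors and then their variables is summing over variables and then
the factors containing them. -/
theorem sum_factor_sum_mem_eq {ι M : Type*} [Fintype ι] [DecidableEq ι] [AddCommMonoid M]
    (A : Finset (Finset ι)) (g : ι → Finset ι → M) :
    ∑ α ∈ A, ∑ i ∈ α, g i α = ∑ i, ∑ α ∈ A.filter (fun α => i ∈ α), g i α :=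
  Finset.sum_comm' (by simp)

/-- Given nonnegative weights `d`, the parameter vector `c`
defined by `c_α = d_αα + ∑_{i∈α} d_iα` and
`c_i = (d_ii − ∑_{α∈∂i} d_iα)/(1 − ∑_{α∈∂i} c_α)` (arbitrary nonzero when the
denominator vanishes) turns the reparameterization into the corresponding
conical combination; in particular any beliefs admissible for `f` with this `c`
express `f` as a conical combination of the beliefs. -/
theorem conical_weights_give_parameters
    {X : Type} [Fintype X] [Nonempty X] {n : ℕ}
    (A : Finset (Finset (Fin n))) (hAne : ∀ α ∈ A, α.Nonempty)
    (dvv : Fin n → ℝ) (dff : Finset (Fin n) → ℝ) (dvf : Fin n → Finset (Fin n) → ℝ)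
    (hdvv : ∀ i, 0 ≤ dvv i) (hdff : ∀ α ∈ A, 0 ≤ dff α)
    (hdvf : ∀ α ∈ A, ∀ i ∈ α, 0 ≤ dvf i α)
    (cv : Fin n → ℝ) (cf : Finset (Fin n) → ℝ)
    (hcf : ∀ α ∈ A, cf α = dff α + ∑ i ∈ α, dvf i α)
    (hcfpos : ∀ α ∈ A, 0 < cf α)
    (hcv : ∀ i, cv i ≠ 0)
    (hcvdef : ∀ i : Fin n,
      (1 - ∑ α ∈ A.filter (fun α => i ∈ α), cf α ≠ 0 →
        dvv i ≠ ∑ α ∈ A.filter (fun α => i ∈ α), dvf i α ∧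
        cv i = (dvv i - ∑ α ∈ A.filter (fun α => i ∈ α), dvf i α) /
          (1 - ∑ α ∈ A.filter (fun α => i ∈ α), cf α)) ∧
      (1 - ∑ α ∈ A.filter (fun α => i ∈ α), cf α = 0 →
        dvv i = ∑ α ∈ A.filter (fun α => i ∈ α), dvf i α)) :
    (∀ (bv : Fin n → X → ℝ) (bf : Finset (Fin n) → (Fin n → X) → ℝ)
        (x : Fin n → X),
      ∑ i, cv i * bv i (x i) +
          ∑ α ∈ A, cf α * (bf α x - ∑ k ∈ α, cv k * bv k (x k)) =
        ∑ i, dvv i * bv i (x i) + ∑ α ∈ A, dff α * bf α x +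
          ∑ α ∈ A, ∑ i ∈ α, dvf i α * (bf α x - bv i (x i))) ∧
    (∀ (f : (Fin n → X) → ℝ) (bv : Fin n → X → ℝ)
        (bf : Finset (Fin n) → (Fin n → X) → ℝ) (κ : ℝ),
      (∀ x : Fin n → X, f x = κ + ∑ i, cv i * bv i (x i) +
        ∑ α ∈ A, cf α * (bf α x - ∑ k ∈ α, cv k * bv k (x k))) →
      ∀ x : Fin n → X, f x = κ +
        ∑ α ∈ A, ∑ i ∈ α, dvf i α * (bf α x - bv i (x i)) +
        ∑ α ∈ A, dff α * bf α x + ∑ i, dvv i * bv i (x i)) := by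
  have hv : ∀ i, cv i - (∑ α ∈ A.filter (fun α => i ∈ α), cf α) * cv i =
      dvv i - ∑ α ∈ A.filter (fun α => i ∈ α), dvf i α := by
    intro i
    obtain ⟨h₁, h₂⟩ := hcvdef i
    by_cases hs : 1 - ∑ α ∈ A.filter (fun α => i ∈ α), cf α = 0
    · linear_combination cv i * hs - h₂ hs
    · have h := (eq_div_iff hs).1 (h₁ hs).2
      linear_combination h
  have key : ∀ (bv : Fin n → X → ℝ) (bf : Finset (Fin n) → (Fin n → X) → ℝ)
      (x : Fin n → X),
      ∑ i, cv i * bv i (x i) +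
          ∑ α ∈ A, cf α * (bf α x - ∑ k ∈ α, cv k * bv k (x k)) =
        ∑ i, dvv i * bv i (x i) + ∑ α ∈ A, dff α * bf α x +
          ∑ α ∈ A, ∑ i ∈ α, dvf i α * (bf α x - bv i (x i)) := by
    intro bv bf x
    have hfactor : ∑ α ∈ A, cf α * bf α x =
        ∑ α ∈ A, dff α * bf α x + ∑ α ∈ A, ∑ i ∈ α, dvf i α * bf α x := by
      rw [← Finset.sum_add_distrib]
      refine Finset.sum_congr rfl fun α hα => ?_
      rw [hcf α hα, add_mul, Finset.sum_mul]
    have hvar : ∑ i, cv i * bv i (x i) - ∑ α ∈ A, ∑ i ∈ α, cf α * (cv i * bv i (x i)) =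
        ∑ i, dvv i * bv i (x i) - ∑ α ∈ A, ∑ i ∈ α, dvf i α * bv i (x i) := by
      rw [sum_factor_sum_mem_eq A fun i α => cf α * (cv i * bv i (x i)),
        sum_factor_sum_mem_eq A fun i α => dvf i α * bv i (x i),
        ← Finset.sum_sub_distrib, ← Finset.sum_sub_distrib]
      refine Finset.sum_congr rfl fun i _ => ?_
      rw [← Finset.sum_mul, ← Finset.sum_mul]
      linear_combination bv i (x i) * hv i
    simp only [mul_sub, Finset.sum_sub_distrib, Finset.mul_sum]
    linear_combination hfactor + hvar
  refine ⟨key, fun f bv bf κ hf x => ?_⟩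
  linear_combination hf x + key bv bf x
end

section
/- Let b be a vector of admissible and min-consistent beliefs for f with a parameter vector c of nonzero reals such that (1 − ∑_{α∈∂i} c_α)·c_i ≥ 0 for every variable i and c_α > 0 for every factor α. If the beliefs admit a unique estimate x*, then x* is a global minimum of f: f(x*) ≤ f(x) for all x : Fin n → X. -/
/-- A min-consistent factor belief is minimized at the unique estimate. -/
theorem factor_belief_le_of_unique_estimate
    {X : Type} [Fintype X] [Nonempty X] {n : ℕ} (α : Finset (Fin n))
    (b : (Fin n → X) → ℝ) (bv : Fin n → X → ℝ)
    (hdep : ∀ x y : Fin n → X, (∀ i ∈ α, x i = y i) → b x = b y)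
    (hmc : ∀ i ∈ α, ∃ κ' : ℝ, ∀ t : X,
      sInf {r : ℝ | ∃ x : Fin n → X, x i = t ∧ b x = r} = κ' + bv i t)
    (xs : Fin n → X)
    (hxs : ∀ i : Fin n, ∀ y : X, y ≠ xs i → bv i (xs i) < bv i y)
    (x : Fin n → X) : b xs ≤ b x := by
  obtain ⟨z, hz⟩ := Finite.exists_min b
  suffices h : ∀ i ∈ α, xs i = z i from (hdep xs z h).le.trans (hz x)
  intro i hi
  by_contra hne
  obtain ⟨κ', hκ⟩ := hmc i hi
  have h₁ : κ' + bv i (z i) ≤ b z := by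
    rw [← hκ]
    refine csInf_le ⟨b z, ?_⟩ ⟨z, rfl, rfl⟩
    rintro _ ⟨y, -, rfl⟩
    exact hz y
  have h₂ : b z ≤ κ' + bv i (xs i) := by
    rw [← hκ]
    refine le_csInf ⟨b xs, xs, rfl, rfl⟩ ?_
    rintro _ ⟨y, -, rfl⟩
    exact hz y
  linarith [hxs i (z i) (Ne.symm hne)]

/-- Collecting the variable beliefs in the admissible decomposition. -/
theorem sum_belief_reparametrization
    {n : ℕ} (A : Finset (Finset (Fin n))) (cf B : Finset (Fin n) → ℝ) (cv v : Fin n → ℝ) :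
    ∑ i, cv i * v i + ∑ α ∈ A, cf α * (B α - ∑ k ∈ α, cv k * v k) =
      ∑ i, (1 - ∑ α ∈ A.filter (fun α => i ∈ α), cf α) * cv i * v i + ∑ α ∈ A, cf α * B α := by
  have h : ∑ α ∈ A, cf α * ∑ k ∈ α, cv k * v k =
      ∑ i, (∑ α ∈ A.filter (fun α => i ∈ α), cf α) * (cv i * v i) := by
    simp_rw [Finset.mul_sum, Finset.sum_mul]
    exact Finset.sum_comm' (by simp)
  simp_rw [mul_sub, Finset.sum_sub_distrib, h, sub_mul, one_mul, Finset.sum_sub_distrib, mul_assoc]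
  ring

/-- If the beliefs are admissible and min-consistent for `f` with
parameters satisfying `(1 − ∑_{α∈∂i} c_α)·c_i ≥ 0` for every `i` and `c_α > 0`
for every `α`, then any unique estimate `x*` is a global minimum of `f`. -/
theorem unique_estimate_global_minimum
    {X : Type} [Fintype X] [Nonempty X] {n : ℕ}
    (A : Finset (Finset (Fin n))) (hAne : ∀ α ∈ A, α.Nonempty)
    (φ : Fin n → X → ℝ) (ψ : Finset (Fin n) → (Fin n → X) → ℝ)
    (hψ : ∀ α ∈ A, ∀ x y : Fin n → X, (∀ i ∈ α, x i = y i) → ψ α x = ψ α y)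
    (f : (Fin n → X) → ℝ)
    (hf : ∀ x, f x = ∑ i, φ i (x i) + ∑ α ∈ A, ψ α x)
    (cv : Fin n → ℝ) (cf : Finset (Fin n) → ℝ)
    (hcv : ∀ i, cv i ≠ 0)
    (hcond1 : ∀ i : Fin n,
      0 ≤ (1 - ∑ α ∈ A.filter (fun α => i ∈ α), cf α) * cv i)
    (hcond2 : ∀ α ∈ A, 0 < cf α)
    (bv : Fin n → X → ℝ) (bf : Finset (Fin n) → (Fin n → X) → ℝ)
    (hbfdep : ∀ α ∈ A, ∀ x y : Fin n → X, (∀ i ∈ α, x i = y i) → bf α x = bf α y)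
    -- admissibility:
    (κ : ℝ)
    (hadm : ∀ x : Fin n → X, f x = κ + ∑ i, cv i * bv i (x i) +
      ∑ α ∈ A, cf α * (bf α x - ∑ k ∈ α, cv k * bv k (x k)))
    -- min-consistency:
    (hmc : ∀ α ∈ A, ∀ i ∈ α, ∃ κ' : ℝ, ∀ t : X,
      sInf {r : ℝ | ∃ x : Fin n → X, x i = t ∧ bf α x = r} = κ' + bv i t)
    -- `xs` is a unique estimate for the beliefs:
    (xs : Fin n → X)
    (hxs : ∀ i : Fin n, ∀ y : X, y ≠ xs i → bv i (xs i) < bv i y) :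
    ∀ x : Fin n → X, f xs ≤ f x := by
  intro x
  rw [hadm, hadm, add_assoc, add_assoc,
    sum_belief_reparametrization A cf (fun α => bf α xs) cv (fun i => bv i (xs i)),
    sum_belief_reparametrization A cf (fun α => bf α x) cv (fun i => bv i (x i))]
  gcongr with i _ α hα
  · exact hcond1 i
  · by_cases h : x i = xs i
    · rw [h]
    · exact (hxs i _ h).le
  · exact (hcond2 α hα).le
  · exact factor_belief_le_of_unique_estimate α (bf α) bv (hbfdep α hα) (hmc α hα) xs hxs x
end

section
/- For any objective function f(x) = ∑_i φ_i(x i) + ∑_{α∈A} ψ_α(x) of the factorized form, there exists a parameter vector c of nonzero reals (with c_α > 0 for all α and (1 − ∑_{α∈∂i} c_α)·c_i ≥ 0 for all i) such that for every vector of beliefs that is admissible and min-consistent for f with parameters c, if the beliefs admit a unique estimate x*, then x* is a global minimum of f. -/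
/-- If the `i`-th min-marginal of `g` agrees with `b i` up to a constant for each `i ∈ α`, `g`
depends only on the coordinates in `α`, and `xs i` is the unique minimizer of each `b i`, then `xs`
minimizes `g`. -/
theorem le_of_minMarginal_unique_minimizer {ι X : Type*} [Finite ι] [Finite X]
    (α : Finset ι) (g : (ι → X) → ℝ) (b : ι → X → ℝ)
    (hg : ∀ x y : ι → X, (∀ i ∈ α, x i = y i) → g x = g y)
    (hmin : ∀ i ∈ α, ∃ κ : ℝ, ∀ t : X,
      sInf {r : ℝ | ∃ x : ι → X, x i = t ∧ g x = r} = κ + b i t)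
    (xs : ι → X) (hxs : ∀ i, ∀ y : X, y ≠ xs i → b i (xs i) < b i y) (x : ι → X) :
    g xs ≤ g x := by
  have : Nonempty (ι → X) := ⟨x⟩
  obtain ⟨z, hz⟩ := Finite.exists_min g
  have hzxs : ∀ i ∈ α, xs i = z i := by
    intro i hi
    by_contra hne
    obtain ⟨κ, hκ⟩ := hmin i hi
    have hlt := hxs i (z i) (Ne.symm hne)
    have hupper : sInf {r : ℝ | ∃ x : ι → X, x i = z i ∧ g x = r} ≤ g z :=
      csInf_le ⟨g z, by rintro _ ⟨y, -, rfl⟩; exact hz y⟩ ⟨z, rfl, rfl⟩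
    have hlower : g z ≤ sInf {r : ℝ | ∃ x : ι → X, x i = xs i ∧ g x = r} :=
      le_csInf ⟨g xs, xs, rfl, rfl⟩ (by rintro _ ⟨y, -, rfl⟩; exact hz y)
    rw [hκ] at hupper hlower
    linarith
  exact (hg xs z hzxs).trans_le (hz x)

/-- Regroups a sum over pairs `k ∈ α ∈ A` by the element `k`. -/
theorem sum_mul_sum_mem_eq_sum_sum_filter_mul {ι : Type*} [Fintype ι] [DecidableEq ι]
    (A : Finset (Finset ι)) (c : Finset ι → ℝ) (v : ι → ℝ) :
    ∑ α ∈ A, c α * ∑ k ∈ α, v k = ∑ i, (∑ α ∈ A.filter (fun α => i ∈ α), c α) * v i := by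
  simp_rw [Finset.mul_sum, Finset.sum_mul]
  exact Finset.sum_comm' (by simp)

/-- For any objective function of the factorized form, there
exists a parameter vector `c` of nonzero reals (with `c_α > 0` for all `α` and
`(1 − ∑_{α∈∂i} c_α)·c_i ≥ 0` for all `i`) such that any unique estimate of any
admissible and min-consistent beliefs is a global minimum of `f`. -/
theorem exists_parameters_guaranteeing_correctness
    {X : Type} [Fintype X] [Nonempty X] {n : ℕ}
    (A : Finset (Finset (Fin n))) (hAne : ∀ α ∈ A, α.Nonempty)
    (φ : Fin n → X → ℝ) (ψ : Finset (Fin n) → (Fin n → X) → ℝ)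
    (hψ : ∀ α ∈ A, ∀ x y : Fin n → X, (∀ i ∈ α, x i = y i) → ψ α x = ψ α y)
    (f : (Fin n → X) → ℝ)
    (hf : ∀ x, f x = ∑ i, φ i (x i) + ∑ α ∈ A, ψ α x) :
    ∃ (cv : Fin n → ℝ) (cf : Finset (Fin n) → ℝ),
      (∀ i, cv i ≠ 0) ∧ (∀ α ∈ A, 0 < cf α) ∧
      (∀ i : Fin n, 0 ≤ (1 - ∑ α ∈ A.filter (fun α => i ∈ α), cf α) * cv i) ∧
      ∀ (bv : Fin n → X → ℝ) (bf : Finset (Fin n) → (Fin n → X) → ℝ),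
        (∀ α ∈ A, ∀ x y : Fin n → X, (∀ i ∈ α, x i = y i) → bf α x = bf α y) →
        ∀ κ : ℝ,
        (∀ x : Fin n → X, f x = κ + ∑ i, cv i * bv i (x i) +
          ∑ α ∈ A, cf α * (bf α x - ∑ k ∈ α, cv k * bv k (x k))) →
        (∀ α ∈ A, ∀ i ∈ α, ∃ κ' : ℝ, ∀ t : X,
          sInf {r : ℝ | ∃ x : Fin n → X, x i = t ∧ bf α x = r} = κ' + bv i t) →
        ∀ xs : Fin n → X,
          (∀ i : Fin n, ∀ y : X, y ≠ xs i → bv i (xs i) < bv i y) →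
          ∀ x : Fin n → X, f xs ≤ f x := by
  have hsum : ∀ i : Fin n,
      ∑ α ∈ A.filter (fun α => i ∈ α), (1 / ((A.card : ℝ) + 1)) ≤ 1 := by
    intro i
    rw [Finset.sum_const, nsmul_eq_mul, mul_one_div, div_le_one (by positivity)]
    have : ((A.filter (fun α => i ∈ α)).card : ℝ) ≤ A.card :=
      mod_cast Finset.card_filter_le _ _
    linarith
  refine ⟨fun _ => 1, fun _ => 1 / ((A.card : ℝ) + 1), fun _ => one_ne_zero,
    fun _ _ => by positivity, fun i => ?_, ?_⟩
  · linarith [hsum i]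
  intro bv bf hbf κ hadm hcons xs hxs x
  have hbv : ∀ i, bv i (xs i) ≤ bv i (x i) := by
    intro i
    by_cases h : x i = xs i
    · rw [h]
    · exact (hxs i _ h).le
  have hregroup : ∀ y : Fin n → X, f y = κ +
      ∑ i, (1 - ∑ α ∈ A.filter (fun α => i ∈ α), (1 / ((A.card : ℝ) + 1))) * bv i (y i) +
      ∑ α ∈ A, (1 / ((A.card : ℝ) + 1)) * bf α y := by
    intro y
    rw [hadm y]
    simp only [one_mul, mul_sub, sub_mul, Finset.sum_sub_distrib]
    rw [sum_mul_sum_mem_eq_sum_sum_filter_mul A (fun _ => 1 / ((A.card : ℝ) + 1))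
      (fun k => bv k (y k))]
    ring
  rw [hregroup xs, hregroup x]
  gcongr with i _ α hα
  · exact sub_nonneg.mpr (hsum i)
  · exact hbv i
  · exact le_of_minMarginal_unique_minimizer α (bf α) bv (hbf α hα) (hcons α hα) xs hxs x
end

section
/- Let b be a vector of admissible and min-consistent beliefs for f with a parameter vector c of nonzero reals such that c_α > 0 for every factor α and (1 − ∑_{α∈∂i} c_α)·c_i ≥ 0 for every variable i. Then for every variable j there exist a real d_j > 0 and a constant κ_j such that for all x_j ∈ X, the min-marginal f_j(x_j) := min over all x : Fin n → X with j-th coordinate equal to x_j of f(x) satisfies f_j(x_j) ≥ κ_j + d_j·b_j(x_j). -/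
/-- A real function on a finite type is bounded below. -/
lemma exists_forall_le_of_finite {Y : Type*} [Finite Y] (g : Y → ℝ) :
    ∃ m : ℝ, ∀ y, m ≤ g y := by
  obtain ⟨m, hm⟩ := (Set.finite_range g).bddBelow
  exact ⟨m, fun y => hm ⟨y, rfl⟩⟩

/-- Expanding the factor terms collects the coefficient `(1 - ∑_{α ∋ i} c α)` of each variable
term. -/
lemma sum_add_sum_mul_sub_sum {ι : Type*} [Fintype ι] [DecidableEq ι]
    (A : Finset (Finset ι)) (c B : Finset ι → ℝ) (u : ι → ℝ) :
    ∑ i, u i + ∑ α ∈ A, c α * (B α - ∑ k ∈ α, u k) =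
      ∑ i, (1 - ∑ α ∈ A.filter (fun α => i ∈ α), c α) * u i + ∑ α ∈ A, c α * B α := by
  have h : ∑ α ∈ A, c α * ∑ k ∈ α, u k =
      ∑ i, (∑ α ∈ A.filter (fun α => i ∈ α), c α) * u i := by
    simp_rw [Finset.mul_sum, Finset.sum_mul, Finset.sum_filter]
    rw [Finset.sum_comm]
    refine Finset.sum_congr rfl fun α _ => ?_
    simp
  simp only [mul_sub, sub_mul, one_mul, Finset.sum_sub_distrib, h]
  ring

/-- If the beliefs are admissible and min-consistent for `f` with
parameters satisfying `c_α > 0` for every factor and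
`(1 − ∑_{α∈∂i} c_α)·c_i ≥ 0` for every variable, then for every variable `j`
the true min-marginal `f_j` dominates `κ_j + d_j·b_j` for some `d_j > 0` and
constant `κ_j`. -/
theorem beliefs_lower_bound_min_marginals
    {X : Type} [Fintype X] [Nonempty X] {n : ℕ}
    (A : Finset (Finset (Fin n))) (hAne : ∀ α ∈ A, α.Nonempty)
    (φ : Fin n → X → ℝ) (ψ : Finset (Fin n) → (Fin n → X) → ℝ)
    (hψ : ∀ α ∈ A, ∀ x y : Fin n → X, (∀ i ∈ α, x i = y i) → ψ α x = ψ α y)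
    (f : (Fin n → X) → ℝ)
    (hf : ∀ x, f x = ∑ i, φ i (x i) + ∑ α ∈ A, ψ α x)
    (cv : Fin n → ℝ) (cf : Finset (Fin n) → ℝ)
    (hcv : ∀ i, cv i ≠ 0)
    (hcond1 : ∀ α ∈ A, 0 < cf α)
    (hcond2 : ∀ i : Fin n,
      0 ≤ (1 - ∑ α ∈ A.filter (fun α => i ∈ α), cf α) * cv i)
    (bv : Fin n → X → ℝ) (bf : Finset (Fin n) → (Fin n → X) → ℝ)
    (hbfdep : ∀ α ∈ A, ∀ x y : Fin n → X, (∀ i ∈ α, x i = y i) → bf α x = bf α y)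
    -- admissibility:
    (κ : ℝ)
    (hadm : ∀ x : Fin n → X, f x = κ + ∑ i, cv i * bv i (x i) +
      ∑ α ∈ A, cf α * (bf α x - ∑ k ∈ α, cv k * bv k (x k)))
    -- min-consistency:
    (hmc : ∀ α ∈ A, ∀ i ∈ α, ∃ κ' : ℝ, ∀ t : X,
      sInf {r : ℝ | ∃ x : Fin n → X, x i = t ∧ bf α x = r} = κ' + bv i t) :
    ∀ j : Fin n, ∃ d : ℝ, 0 < d ∧ ∃ κj : ℝ, ∀ t : X,
      κj + d * bv j t ≤
        sInf {r : ℝ | ∃ x : Fin n → X, x j = t ∧ f x = r} := by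
  intro j
  have hfactor : ∀ α : Finset (Fin n), ∃ m : ℝ, α ∈ A → ∀ x : Fin n → X,
      m + (if j ∈ α then bv j (x j) else 0) ≤ bf α x := by
    intro α
    by_cases hα : α ∈ A
    · by_cases hj : j ∈ α
      · obtain ⟨m, hm⟩ := hmc α hα j hj
        refine ⟨m, fun _ x => ?_⟩
        rw [if_pos hj, ← hm (x j)]
        refine csInf_le ?_ ⟨x, rfl, rfl⟩
        refine (Set.finite_range (bf α)).bddBelow.mono ?_
        rintro r ⟨y, -, rfl⟩
        exact ⟨y, rfl⟩
      · obtain ⟨m, hm⟩ := exists_forall_le_of_finite (bf α)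
        exact ⟨m, fun _ x => by simpa [hj] using hm x⟩
    · exact ⟨0, fun h => absurd h hα⟩
  choose m hm using hfactor
  choose l hl using fun i => exists_forall_le_of_finite (bv i)
  set S : Fin n → ℝ := fun i => ∑ α ∈ A.filter (fun α => i ∈ α), cf α with hS
  have hvar : ∀ i (x : Fin n → X),
      (1 - S i) * cv i * (if i = j then 0 else l i) +
        (if i = j then (1 - S j) * cv j * bv j (x j) else 0) ≤
      (1 - S i) * (cv i * bv i (x i)) := by
    intro i x
    by_cases hij : i = j
    · subst hij
      simp [mul_assoc]
    · simpa [hij, mul_assoc] using mul_le_mul_of_nonneg_left (hl i (x i)) (hcond2 i)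
  refine ⟨(1 - S j) * cv j + S j, ?_,
    κ + ∑ i, (1 - S i) * cv i * (if i = j then 0 else l i) + ∑ α ∈ A, cf α * m α,
    fun t => ?_⟩
  · rcases (A.filter (fun α => j ∈ α)).eq_empty_or_nonempty with h | h
    · have hSj : S j = 0 := by simp only [hS, h, Finset.sum_empty]
      have hc := hcond2 j
      rw [h, Finset.sum_empty, sub_zero, one_mul] at hc
      simpa [hSj] using lt_of_le_of_ne hc (hcv j).symm
    · exact add_pos_of_nonneg_of_pos (hcond2 j)
        (Finset.sum_pos (fun α hα => hcond1 α (Finset.mem_filter.mp hα).1) h)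
  · refine le_csInf ⟨_, fun _ => t, rfl, rfl⟩ ?_
    rintro r ⟨x, rfl, rfl⟩
    have hv := Finset.sum_le_sum fun i (_ : i ∈ Finset.univ) => hvar i x
    have hfac := Finset.sum_le_sum fun α (hα : α ∈ A) =>
      mul_le_mul_of_nonneg_left (hm α hα x) (hcond1 α hα).le
    have hsum : ∑ α ∈ A, cf α * (if j ∈ α then bv j (x j) else 0) = S j * bv j (x j) := by
      simp [hS, Finset.sum_mul, Finset.sum_filter]
    rw [Finset.sum_add_distrib, Finset.sum_ite_eq' Finset.univ j, if_pos (Finset.mem_univ j)] at hv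
    simp only [mul_add, Finset.sum_add_distrib, hsum] at hfac
    have hexp := sum_add_sum_mul_sub_sum A cf (fun α => bf α x) (fun i => cv i * bv i (x i))
    rw [hadm x]
    linarith
end

section
/- Suppose c_i = 1 for every variable i and the c_α are nonzero reals. Fix a variable j and a factor β ∈ ∂j, let m be any vector of messages, and let m⁺ be the vector obtained from m by the asynchronous update over the edge (j, β): for each i ∈ β with i ≠ j, set m⁺_{i→β}(x_i) = φ_i(x_i) + (c_β − 1)·m_{β→i}(x_i) + ∑_{α∈∂i, α≠β} c_α·m_{α→i}(x_i); then set m⁺_{β→j}(x_j) = min over all x with j-th coordinate x_j of [ ψ_β(x)/c_β + ∑_{k∈β, k≠j} m⁺_{k→β}(x k) ]; all other messages are unchanged. Then the beliefs b⁺ derived from m⁺ satisfy: there is a constant κ such that for all x_j ∈ X, the minimum of b⁺_β(x) over all x with j-th coordinate equal to x_j equals κ + b⁺_j(x_j) (i.e., b⁺_β is min-consistent with respect to b⁺_j). -/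
/-- The minimum over a fibre of a finite function space commutes with adding a quantity that is
constant on that fibre. -/
theorem sInf_fiber_add_const {Y : Type*} [Finite Y] {X : Type*} (p : Y → X) (t : X) (ht : ∃ y, p y = t)
    (f g : Y → ℝ) (c : ℝ) (hfg : ∀ y, p y = t → g y = f y + c) :
    sInf {r : ℝ | ∃ y, p y = t ∧ g y = r} = sInf {r : ℝ | ∃ y, p y = t ∧ f y = r} + c := by
  obtain ⟨y₀, hy₀⟩ := ht
  have hne : {r : ℝ | ∃ y, p y = t ∧ f y = r}.Nonempty := ⟨f y₀, y₀, hy₀, rfl⟩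
  have hbdd : BddBelow {r : ℝ | ∃ y, p y = t ∧ f y = r} :=
    ((Set.finite_range f).subset (by rintro _ ⟨y, -, rfl⟩; exact ⟨y, rfl⟩)).bddBelow
  have himage : {r : ℝ | ∃ y, p y = t ∧ g y = r} =
      OrderIso.addRight c '' {r : ℝ | ∃ y, p y = t ∧ f y = r} := by
    ext r
    constructor
    · rintro ⟨y, hy, rfl⟩
      exact ⟨f y, ⟨y, hy, rfl⟩, (hfg y hy).symm⟩
    · rintro ⟨_, ⟨y, hy, rfl⟩, rfl⟩
      exact ⟨y, hy, hfg y hy⟩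
  rw [himage, ← (OrderIso.addRight c).map_csInf' hne hbdd]
  rfl

/-- With `c_i = 1` for all variables, after the asynchronous
update over the edge `(j, β)`, the updated factor belief `b⁺_β` is
min-consistent with respect to the updated variable belief `b⁺_j`. -/
theorem asynchronous_edge_update_min_consistent
    {X : Type} [Fintype X] [Nonempty X] {n : ℕ}
    (A : Finset (Finset (Fin n))) (hAne : ∀ α ∈ A, α.Nonempty)
    (φ : Fin n → X → ℝ) (ψ : Finset (Fin n) → (Fin n → X) → ℝ)
    (hψ : ∀ α ∈ A, ∀ x y : Fin n → X, (∀ i ∈ α, x i = y i) → ψ α x = ψ α y)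
    (cf : Finset (Fin n) → ℝ) (hcf : ∀ α ∈ A, cf α ≠ 0)
    -- the edge (j, β):
    (j : Fin n) (β : Finset (Fin n)) (hβ : β ∈ A) (hjβ : j ∈ β)
    -- the messages before the update:
    (mva : Fin n → Finset (Fin n) → X → ℝ)
    (maf : Finset (Fin n) → Fin n → X → ℝ)
    -- the messages after the asynchronous update over the edge (j, β):
    (mva' : Fin n → Finset (Fin n) → X → ℝ)
    (maf' : Finset (Fin n) → Fin n → X → ℝ)
    (hup1 : ∀ i ∈ β, i ≠ j → ∀ t : X,
      mva' i β t = φ i t + (cf β - 1) * maf β i t +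
        ∑ α ∈ (A.filter (fun α => i ∈ α)).erase β, cf α * maf α i t)
    (hup2 : ∀ t : X,
      maf' β j t = sInf {r : ℝ | ∃ x : Fin n → X, x j = t ∧
        ψ β x / cf β + ∑ k ∈ β.erase j, mva' k β (x k) = r})
    (hun1 : ∀ (i : Fin n) (α : Finset (Fin n)),
      ¬(α = β ∧ i ∈ β ∧ i ≠ j) → mva' i α = mva i α)
    (hun2 : ∀ (α : Finset (Fin n)) (i : Fin n),
      ¬(α = β ∧ i = j) → maf' α i = maf α i)
    -- the beliefs derived from the updated messages (with c_i = 1):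
    (bv' : Fin n → X → ℝ) (bf' : Finset (Fin n) → (Fin n → X) → ℝ)
    (hbv' : ∀ (i : Fin n) (t : X), bv' i t = φ i t +
      ∑ α ∈ A.filter (fun α => i ∈ α), cf α * maf' α i t)
    (hbf' : ∀ α ∈ A, ∀ x : Fin n → X, bf' α x = ψ α x / cf α +
      ∑ k ∈ α, (φ k (x k) + (cf α - 1) * maf' α k (x k) +
        ∑ γ ∈ (A.filter (fun γ => k ∈ γ)).erase α, cf γ * maf' γ k (x k))) :
    ∃ κ : ℝ, ∀ t : X,
      sInf {r : ℝ | ∃ x : Fin n → X, x j = t ∧ bf' β x = r} = κ + bv' j t := by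
  refine ⟨0, fun t => ?_⟩
  have hbelief : ∀ x : Fin n → X, x j = t → bf' β x =
      (ψ β x / cf β + ∑ k ∈ β.erase j, mva' k β (x k)) +
        (φ j t + (cf β - 1) * maf' β j t +
          ∑ γ ∈ (A.filter (fun γ => j ∈ γ)).erase β, cf γ * maf' γ j t) := by
    rintro x rfl
    rw [hbf' β hβ x, ← Finset.sum_erase_add β _ hjβ, ← add_assoc]
    congr 2
    refine Finset.sum_congr rfl fun k hk => ?_
    obtain ⟨hkj, hkβ⟩ := Finset.mem_erase.mp hk
    rw [hup1 k hkβ hkj, hun2 β k (fun h => hkj h.2)]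
    congr 1
    refine Finset.sum_congr rfl fun γ hγ => ?_
    rw [hun2 γ k (fun h => hkj h.2)]
  rw [sInf_fiber_add_const (fun x : Fin n → X => x j) t ⟨fun _ => t, rfl⟩ _ _ _ hbelief,
    ← hup2 t, hbv' j t,
    ← Finset.sum_erase_add _ _ (Finset.mem_filter.mpr ⟨hβ, hjβ⟩ : β ∈ A.filter (fun γ => j ∈ γ))]
  ring
end

section
/- Suppose c_i = 1 for every variable i, c_α > 0 for every factor α, and ∑_{α∈∂i} c_α ≤ 1 for every variable i. Fix a variable j, let m be any vector of messages, and let m⁺ be the vector obtained by the asynchronous update for variable j: for every β ∈ ∂j and every i ∈ β with i ≠ j, m⁺_{i→β}(x_i) = φ_i(x_i) + (c_β − 1)·m_{β→i}(x_i) + ∑_{α∈∂i, α≠β} c_α·m_{α→i}(x_i); for every β ∈ ∂j, m⁺_{β→j}(x_j) = min over all x with j-th coordinate x_j of [ ψ_β(x)/c_β + ∑_{k∈β, k≠j} m⁺_{k→β}(x k) ]; all other messages unchanged. Then LB(m⁺) ≥ LB(m): the asynchronous update for a variable cannot decrease the lower bound. -/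
/-- The contribution of the variable `k` to the belief of a factor `α ∋ k` is the belief of `k`
minus the message from `α` to `k`. -/
lemma factor_contribution_eq_belief_sub_message
    {X : Type} {n : ℕ} {A : Finset (Finset (Fin n))} {φ : Fin n → X → ℝ}
    {cf : Finset (Fin n) → ℝ} {maf : Finset (Fin n) → Fin n → X → ℝ} {bv : Fin n → X → ℝ}
    (hbv : ∀ (i : Fin n) (t : X), bv i t = φ i t +
      ∑ α ∈ A.filter (fun α => i ∈ α), cf α * maf α i t)
    {α : Finset (Fin n)} (hα : α ∈ A) {k : Fin n} (hk : k ∈ α) (t : X) :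
    φ k t + (cf α - 1) * maf α k t +
      ∑ γ ∈ (A.filter (fun γ => k ∈ γ)).erase α, cf γ * maf γ k t = bv k t - maf α k t := by
  have h := Finset.add_sum_erase (A.filter (fun γ => k ∈ γ)) (fun γ => cf γ * maf γ k t)
    (Finset.mem_filter.mpr ⟨hα, hk⟩)
  rw [hbv, ← h]
  ring

/-- The admissibility constant of the beliefs derived from messages is zero. -/
lemma admissibility_constant_eq_zero
    {X : Type} [Nonempty X] {n : ℕ} {A : Finset (Finset (Fin n))}
    {φ : Fin n → X → ℝ} {ψ : Finset (Fin n) → (Fin n → X) → ℝ} {f : (Fin n → X) → ℝ}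
    (hf : ∀ x, f x = ∑ i, φ i (x i) + ∑ α ∈ A, ψ α x)
    {cf : Finset (Fin n) → ℝ} (hcfpos : ∀ α ∈ A, 0 < cf α)
    {maf : Finset (Fin n) → Fin n → X → ℝ}
    {bv : Fin n → X → ℝ} {bf : Finset (Fin n) → (Fin n → X) → ℝ}
    (hbv : ∀ (i : Fin n) (t : X), bv i t = φ i t +
      ∑ α ∈ A.filter (fun α => i ∈ α), cf α * maf α i t)
    (hbf : ∀ α ∈ A, ∀ x : Fin n → X,
      bf α x = ψ α x / cf α + ∑ k ∈ α, (bv k (x k) - maf α k (x k)))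
    {κ : ℝ}
    (hκ : ∀ x : Fin n → X, f x = κ +
      ∑ i, (1 - ∑ α ∈ A.filter (fun α => i ∈ α), cf α) * bv i (x i) +
      ∑ α ∈ A, cf α * bf α x) : κ = 0 := by
  obtain ⟨x⟩ : Nonempty (Fin n → X) := inferInstance
  have h1 : ∑ α ∈ A, cf α * bf α x = ∑ α ∈ A, ψ α x +
      ∑ α ∈ A, ∑ k ∈ α, cf α * (bv k (x k) - maf α k (x k)) := by
    rw [← Finset.sum_add_distrib]
    refine Finset.sum_congr rfl fun α hα => ?_
    rw [hbf α hα, mul_add, mul_div_cancel₀ _ (hcfpos α hα).ne', Finset.mul_sum]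
  have h2 : ∑ α ∈ A, ∑ k ∈ α, cf α * (bv k (x k) - maf α k (x k)) =
      ∑ k, ∑ α ∈ A.filter (fun α => k ∈ α), cf α * (bv k (x k) - maf α k (x k)) :=
    Finset.sum_comm' (by simp)
  have h3 : ∑ i, (1 - ∑ α ∈ A.filter (fun α => i ∈ α), cf α) * bv i (x i) +
      ∑ k, ∑ α ∈ A.filter (fun α => k ∈ α), cf α * (bv k (x k) - maf α k (x k)) =
      ∑ i, φ i (x i) := by
    rw [← Finset.sum_add_distrib]
    refine Finset.sum_congr rfl fun i _ => ?_
    simp only [mul_sub, Finset.sum_sub_distrib, ← Finset.sum_mul]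
    linarith [hbv i (x i)]
  linarith [hf x, hκ x]


/-- With `c_i = 1`, `c_α > 0`, and `∑_{α∈∂i} c_α ≤ 1`, the
asynchronous update for a single variable `j` cannot decrease the lower bound
`LB(m)`. -/
theorem asynchronous_variable_update_improves_lower_bound
    {X : Type} [Fintype X] [Nonempty X] {n : ℕ}
    (A : Finset (Finset (Fin n))) (hAne : ∀ α ∈ A, α.Nonempty)
    (φ : Fin n → X → ℝ) (ψ : Finset (Fin n) → (Fin n → X) → ℝ)
    (hψ : ∀ α ∈ A, ∀ x y : Fin n → X, (∀ i ∈ α, x i = y i) → ψ α x = ψ α y)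
    (f : (Fin n → X) → ℝ)
    (hf : ∀ x, f x = ∑ i, φ i (x i) + ∑ α ∈ A, ψ α x)
    (cf : Finset (Fin n) → ℝ)
    (hcfpos : ∀ α ∈ A, 0 < cf α)
    (hcfsum : ∀ i : Fin n, ∑ α ∈ A.filter (fun α => i ∈ α), cf α ≤ 1)
    -- the variable to be updated:
    (j : Fin n)
    -- the messages before the update:
    (mva : Fin n → Finset (Fin n) → X → ℝ)
    (maf : Finset (Fin n) → Fin n → X → ℝ)
    -- the messages after the asynchronous update for the variable j:
    (mva' : Fin n → Finset (Fin n) → X → ℝ)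
    (maf' : Finset (Fin n) → Fin n → X → ℝ)
    (hup1 : ∀ β ∈ A, j ∈ β → ∀ i ∈ β, i ≠ j → ∀ t : X,
      mva' i β t = φ i t + (cf β - 1) * maf β i t +
        ∑ α ∈ (A.filter (fun α => i ∈ α)).erase β, cf α * maf α i t)
    (hup2 : ∀ β ∈ A, j ∈ β → ∀ t : X,
      maf' β j t = sInf {r : ℝ | ∃ x : Fin n → X, x j = t ∧
        ψ β x / cf β + ∑ k ∈ β.erase j, mva' k β (x k) = r})
    (hun1 : ∀ (i : Fin n) (α : Finset (Fin n)),
      ¬(α ∈ A ∧ j ∈ α ∧ i ∈ α ∧ i ≠ j) → mva' i α = mva i α)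
    (hun2 : ∀ (α : Finset (Fin n)) (i : Fin n),
      ¬(α ∈ A ∧ j ∈ α ∧ i = j) → maf' α i = maf α i)
    -- the beliefs derived from the old messages (with c_i = 1):
    (bv : Fin n → X → ℝ) (bf : Finset (Fin n) → (Fin n → X) → ℝ)
    (hbv : ∀ (i : Fin n) (t : X), bv i t = φ i t +
      ∑ α ∈ A.filter (fun α => i ∈ α), cf α * maf α i t)
    (hbf : ∀ α ∈ A, ∀ x : Fin n → X, bf α x = ψ α x / cf α +
      ∑ k ∈ α, (φ k (x k) + (cf α - 1) * maf α k (x k) +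
        ∑ γ ∈ (A.filter (fun γ => k ∈ γ)).erase α, cf γ * maf γ k (x k)))
    -- the beliefs derived from the updated messages (with c_i = 1):
    (bv' : Fin n → X → ℝ) (bf' : Finset (Fin n) → (Fin n → X) → ℝ)
    (hbv' : ∀ (i : Fin n) (t : X), bv' i t = φ i t +
      ∑ α ∈ A.filter (fun α => i ∈ α), cf α * maf' α i t)
    (hbf' : ∀ α ∈ A, ∀ x : Fin n → X, bf' α x = ψ α x / cf α +
      ∑ k ∈ α, (φ k (x k) + (cf α - 1) * maf' α k (x k) +
        ∑ γ ∈ (A.filter (fun γ => k ∈ γ)).erase α, cf γ * maf' γ k (x k)))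
    -- the admissibility constants of the two belief vectors:
    (κ κ' : ℝ)
    (hκ : ∀ x : Fin n → X, f x = κ +
      ∑ i, (1 - ∑ α ∈ A.filter (fun α => i ∈ α), cf α) * bv i (x i) +
      ∑ α ∈ A, cf α * bf α x)
    (hκ' : ∀ x : Fin n → X, f x = κ' +
      ∑ i, (1 - ∑ α ∈ A.filter (fun α => i ∈ α), cf α) * bv' i (x i) +
      ∑ α ∈ A, cf α * bf' α x) :
    κ + ∑ i, (1 - ∑ α ∈ A.filter (fun α => i ∈ α), cf α) *
          sInf (Set.range (bv i)) +
        ∑ α ∈ A, cf α * sInf (Set.range (bf α)) ≤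
      κ' + ∑ i, (1 - ∑ α ∈ A.filter (fun α => i ∈ α), cf α) *
          sInf (Set.range (bv' i)) +
        ∑ α ∈ A, cf α * sInf (Set.range (bf' α)) := by
  have hc := fun {α} (hα : α ∈ A) {k} (hk : k ∈ α) t =>
    factor_contribution_eq_belief_sub_message hbv hα hk t
  have hc' := fun {α} (hα : α ∈ A) {k} (hk : k ∈ α) t =>
    factor_contribution_eq_belief_sub_message hbv' hα hk t
  replace hbf : ∀ α ∈ A, ∀ x : Fin n → X,
      bf α x = ψ α x / cf α + ∑ k ∈ α, (bv k (x k) - maf α k (x k)) := fun α hα x => by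
    rw [hbf α hα x, Finset.sum_congr rfl fun k hk => hc hα hk (x k)]
  replace hbf' : ∀ α ∈ A, ∀ x : Fin n → X,
      bf' α x = ψ α x / cf α + ∑ k ∈ α, (bv' k (x k) - maf' α k (x k)) := fun α hα x => by
    rw [hbf' α hα x, Finset.sum_congr rfl fun k hk => hc' hα hk (x k)]
  rw [admissibility_constant_eq_zero hf hcfpos hbv hbf hκ,
    admissibility_constant_eq_zero hf hcfpos hbv' hbf' hκ', zero_add, zero_add]
  have hmaf : ∀ α k, k ≠ j → maf' α k = maf α k := fun α k hk => hun2 α k fun h => hk h.2.2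
  have hbv_ne : ∀ k, k ≠ j → bv' k = bv k := fun k hk => by
    ext t
    simp only [hbv, hbv', hmaf _ k hk]
  have hbf_notMem : ∀ α ∈ A, j ∉ α → bf' α = bf α := fun α hα hj => by
    ext x
    rw [hbf α hα, hbf' α hα]
    congr 1
    refine Finset.sum_congr rfl fun k hk => ?_
    have hkj : k ≠ j := fun h => hj (h ▸ hk)
    rw [hbv_ne k hkj, hmaf α k hkj]
  set g : Finset (Fin n) → (Fin n → X) → ℝ :=
    fun β x => ψ β x / cf β + ∑ k ∈ β.erase j, mva' k β (x k)
  have hbf_mem : ∀ β ∈ A, j ∈ β → ∀ x,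
      bf β x = g β x + (bv j (x j) - maf β j (x j)) := fun β hβ hj x => by
    have h : ∑ k ∈ β.erase j, mva' k β (x k) =
        ∑ k ∈ β.erase j, (bv k (x k) - maf β k (x k)) :=
      Finset.sum_congr rfl fun k hk => by
        obtain ⟨hkj, hkβ⟩ := Finset.mem_erase.mp hk
        rw [hup1 β hβ hj k hkβ hkj, hc hβ hkβ]
    rw [hbf β hβ x, ← Finset.add_sum_erase _ _ hj, ← h]
    ring
  have hbf_mem' : ∀ β ∈ A, j ∈ β → ∀ x,
      bf' β x = g β x + (bv' j (x j) - maf' β j (x j)) := fun β hβ hj x => by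
    have h : ∑ k ∈ β.erase j, mva' k β (x k) =
        ∑ k ∈ β.erase j, (bv' k (x k) - maf' β k (x k)) :=
      Finset.sum_congr rfl fun k hk => by
        obtain ⟨hkj, hkβ⟩ := Finset.mem_erase.mp hk
        rw [hup1 β hβ hj k hkβ hkj, hc hβ hkβ, hbv_ne k hkj, hmaf β k hkj]
    rw [hbf' β hβ x, ← Finset.add_sum_erase _ _ hj, ← h]
    ring
  have hfin : ∀ β t, {r : ℝ | ∃ x : Fin n → X, x j = t ∧ g β x = r}.Finite := fun β t =>
    (Set.finite_range (g β)).subset (by rintro r ⟨x, -, rfl⟩; exact ⟨x, rfl⟩)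
  have hmsg_le : ∀ β ∈ A, j ∈ β → ∀ x, maf' β j (x j) ≤ g β x := fun β hβ hj x => by
    rw [hup2 β hβ hj]
    exact csInf_le (hfin β (x j)).bddBelow ⟨x, rfl, rfl⟩
  have hmsg_attained : ∀ β ∈ A, j ∈ β → ∀ t, ∃ x, x j = t ∧ g β x = maf' β j t :=
    fun β hβ hj t => by
      rw [hup2 β hβ hj]
      have hne : {r : ℝ | ∃ x : Fin n → X, x j = t ∧ g β x = r}.Nonempty :=
        ⟨g β fun _ => t, fun _ => t, rfl, rfl⟩
      exact hne.csInf_mem (hfin β t)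
  obtain ⟨t, ht⟩ : sInf (Set.range (bv' j)) ∈ Set.range (bv' j) :=
    (Set.range_nonempty _).csInf_mem (Set.finite_range _)
  have hnew : ∀ β ∈ A.filter (fun α => j ∈ α),
      cf β * bv' j t ≤ cf β * sInf (Set.range (bf' β)) := fun β hβ => by
    obtain ⟨hβ, hj⟩ := Finset.mem_filter.mp hβ
    refine mul_le_mul_of_nonneg_left (le_csInf (Set.range_nonempty _) ?_) (hcfpos β hβ).le
    rintro _ ⟨x, rfl⟩
    have h : bv' j t ≤ bv' j (x j) :=
      ht.trans_le (csInf_le (Set.finite_range _).bddBelow ⟨x j, rfl⟩)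
    linarith [hbf_mem' β hβ hj x, hmsg_le β hβ hj x]
  have hold : ∀ β ∈ A.filter (fun α => j ∈ α), cf β * sInf (Set.range (bf β)) ≤
      cf β * bv j t + cf β * maf' β j t - cf β * maf β j t := fun β hβ => by
    obtain ⟨hβ, hj⟩ := Finset.mem_filter.mp hβ
    obtain ⟨x, rfl, hx⟩ := hmsg_attained β hβ hj t
    rw [← mul_add, ← mul_sub]
    refine mul_le_mul_of_nonneg_left ?_ (hcfpos β hβ).le
    have h : sInf (Set.range (bf β)) ≤ bf β x := csInf_le (Set.finite_range _).bddBelow ⟨x, rfl⟩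
    linarith [hbf_mem β hβ hj x]
  replace hnew := Finset.sum_le_sum hnew
  replace hold := Finset.sum_le_sum hold
  rw [← Finset.sum_mul] at hnew
  rw [Finset.sum_sub_distrib, Finset.sum_add_distrib, ← Finset.sum_mul] at hold
  have hvar : (1 - ∑ α ∈ A.filter (fun α => j ∈ α), cf α) * sInf (Set.range (bv j)) ≤
      (1 - ∑ α ∈ A.filter (fun α => j ∈ α), cf α) * bv j t :=
    mul_le_mul_of_nonneg_left (csInf_le (Set.finite_range _).bddBelow ⟨t, rfl⟩)
      (sub_nonneg.mpr (hcfsum j))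
  have hvars : ∑ i ∈ Finset.univ.erase j, (1 - ∑ α ∈ A.filter (fun α => i ∈ α), cf α) *
        sInf (Set.range (bv' i)) =
      ∑ i ∈ Finset.univ.erase j, (1 - ∑ α ∈ A.filter (fun α => i ∈ α), cf α) *
        sInf (Set.range (bv i)) :=
    Finset.sum_congr rfl fun i hi => by rw [hbv_ne i (Finset.ne_of_mem_erase hi)]
  have hfactors : ∑ α ∈ A.filter (fun α => j ∉ α), cf α * sInf (Set.range (bf' α)) =
      ∑ α ∈ A.filter (fun α => j ∉ α), cf α * sInf (Set.range (bf α)) :=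
    Finset.sum_congr rfl fun α hα => by
      rw [hbf_notMem α (Finset.mem_filter.mp hα).1 (Finset.mem_filter.mp hα).2]
  rw [← Finset.add_sum_erase _ _ (Finset.mem_univ j),
    ← Finset.add_sum_erase Finset.univ (fun i =>
      (1 - ∑ α ∈ A.filter (fun α => i ∈ α), cf α) * sInf (Set.range (bv' i))) (Finset.mem_univ j),
    ← Finset.sum_filter_add_sum_filter_not A (fun α => j ∈ α),
    ← Finset.sum_filter_add_sum_filter_not A (fun α => j ∈ α)
      (fun α => cf α * sInf (Set.range (bf' α))), hvars, hfactors, ← ht]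
  linarith [hbv j t, hbv' j t]
end

section
/- Let b be a vector of beliefs admissible for f with parameter vector c of nonzero reals such that c_α ≥ 0 for every factor α and c_i·(1 − ∑_{α∈∂i} c_α) ≥ 0 for every variable i. If x* simultaneously minimizes all of the beliefs — b_i(x* i) ≤ b_i(y) for every i and y ∈ X, and b_α(x*) ≤ b_α(x) for every α and x — then x* is a global minimum of f: f(x*) ≤ f(x) for all x. -/
/-- Exchanging the order of summation over incident pairs of a factor and a variable. -/
theorem sum_factor_mul_sum_mem {ι R : Type*} [Fintype ι] [DecidableEq ι] [CommSemiring R]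
    (A : Finset (Finset ι)) (c : Finset ι → R) (g : ι → R) :
    ∑ α ∈ A, c α * ∑ k ∈ α, g k = ∑ i, (∑ α ∈ A with i ∈ α, c α) * g i := by
  simp_rw [Finset.mul_sum, Finset.sum_mul]
  exact Finset.sum_comm' (by simp)

/-- If the beliefs are admissible for `f` with parameters
satisfying `c_α ≥ 0` for every factor and `c_i·(1 − ∑_{α∈∂i} c_α) ≥ 0` for
every variable, then any assignment `x*` that simultaneously minimizes all of
the beliefs is a global minimum of `f`. -/
theorem simultaneous_minimizer_global_minimum
    {X : Type} [Fintype X] [Nonempty X] {n : ℕ}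
    (A : Finset (Finset (Fin n))) (hAne : ∀ α ∈ A, α.Nonempty)
    (φ : Fin n → X → ℝ) (ψ : Finset (Fin n) → (Fin n → X) → ℝ)
    (hψ : ∀ α ∈ A, ∀ x y : Fin n → X, (∀ i ∈ α, x i = y i) → ψ α x = ψ α y)
    (f : (Fin n → X) → ℝ)
    (hf : ∀ x, f x = ∑ i, φ i (x i) + ∑ α ∈ A, ψ α x)
    (cv : Fin n → ℝ) (cf : Finset (Fin n) → ℝ)
    (hcv : ∀ i, cv i ≠ 0) (hcf : ∀ α ∈ A, cf α ≠ 0)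
    (hcond1 : ∀ α ∈ A, 0 ≤ cf α)
    (hcond2 : ∀ i : Fin n,
      0 ≤ cv i * (1 - ∑ α ∈ A.filter (fun α => i ∈ α), cf α))
    (bv : Fin n → X → ℝ) (bf : Finset (Fin n) → (Fin n → X) → ℝ)
    (hbfdep : ∀ α ∈ A, ∀ x y : Fin n → X, (∀ i ∈ α, x i = y i) → bf α x = bf α y)
    -- admissibility:
    (κ : ℝ)
    (hadm : ∀ x : Fin n → X, f x = κ + ∑ i, cv i * bv i (x i) +
      ∑ α ∈ A, cf α * (bf α x - ∑ k ∈ α, cv k * bv k (x k)))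
    -- `xs` simultaneously minimizes all of the beliefs:
    (xs : Fin n → X)
    (hxs1 : ∀ (i : Fin n) (y : X), bv i (xs i) ≤ bv i y)
    (hxs2 : ∀ α ∈ A, ∀ x : Fin n → X, bf α xs ≤ bf α x) :
    ∀ x : Fin n → X, f xs ≤ f x := by
  have hreparam (x : Fin n → X) :
      f x = κ + ∑ i, cv i * (1 - ∑ α ∈ A with i ∈ α, cf α) * bv i (x i) +
        ∑ α ∈ A, cf α * bf α x := by
    have hvar : ∑ i, cv i * (1 - ∑ α ∈ A with i ∈ α, cf α) * bv i (x i) =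
        ∑ i, cv i * bv i (x i) - ∑ i, (∑ α ∈ A with i ∈ α, cf α) * (cv i * bv i (x i)) := by
      rw [← Finset.sum_sub_distrib]
      exact Finset.sum_congr rfl fun i _ => by ring
    simp_rw [hadm x, mul_sub (cf _), Finset.sum_sub_distrib, sum_factor_mul_sum_mem, hvar]
    ring
  intro x
  rw [hreparam, hreparam]
  gcongr with i _ α hα
  · exact hcond2 i
  · exact hxs1 i (x i)
  · exact hcond1 α hα
  · exact hxs2 α hα x
end
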